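/- Let X be a compact metric space of topological dimension 1 with H^1(X) < ∞. Then X contains a 1-rectifiable subset of positive H^1-measure. -/

import Mathlib

open MeasureTheory Metric Set Filter
open scoped ENNReal NNReal Topology

/-- The (Lebesgue covering) topological dimension of `X` is at most `n`:
every open cover admits an open refinement that covers `X` and has order at most `n + 1`,
i.e., every point lies in at most `n + 1` members of the refinement. -/
def CovDimLE (X : Type*) [TopologicalSpace X] (n : ℕ) : Prop :=
  ∀ 𝒰 : Set (Set X), (∀ U ∈ 𝒰, IsOpen U) → ⋃₀ 𝒰 = univ →
    ∃ 𝒱 : Set (Set X), (∀ V ∈ 𝒱, IsOpen V) ∧ ⋃₀ 𝒱 = univ ∧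
      (∀ V ∈ 𝒱, ∃ U ∈ 𝒰, V ⊆ U) ∧
      ∀ x : X, {V ∈ 𝒱 | x ∈ V}.Finite ∧ {V ∈ 𝒱 | x ∈ V}.ncard ≤ n + 1

/-- The topological (covering) dimension of `X` equals `n`. -/
def CovDimEq (X : Type*) [TopologicalSpace X] (n : ℕ) : Prop :=
  CovDimLE X n ∧ ∀ m : ℕ, CovDimLE X m → n ≤ m

/-- An `H^1`-measurable set `E` in a metric space `X` is `1`-rectifiable if there are
measurable sets `F i ⊆ ℝ` and Lipschitz maps `f i : F i → X` such that
`H^1 (E \ ⋃ i, f i '' F i) = 0`. -/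
def IsRectifiableSet1 {X : Type*} [MetricSpace X] [MeasurableSpace X] [BorelSpace X]
    (E : Set X) : Prop :=
  MeasurableSet E ∧
  ∃ (F : ℕ → Set ℝ) (f : ℕ → ℝ → X),
    (∀ i, MeasurableSet (F i)) ∧ (∀ i, ∃ K : ℝ≥0, LipschitzOnWith K (f i) (F i)) ∧
    μH[1] (E \ ⋃ i, f i '' F i) = 0

/-- A totally disconnected compact metric space has covering dimension at most zero. -/
theorem CovDimLE.zero_of_totallyDisconnectedSpace {X : Type*} [MetricSpace X] [CompactSpace X]
    [TotallyDisconnectedSpace X] : CovDimLE X 0 := by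
  intro 𝒰 hopen hcover
  have hbasis : ∀ x : X, ∃ V : Set X, IsClopen V ∧ x ∈ V ∧ ∃ U ∈ 𝒰, V ⊆ U := by
    intro x
    obtain ⟨U, hU, hxU⟩ := mem_sUnion.1 (hcover ▸ mem_univ x)
    obtain ⟨V, hV, hxV, hVU⟩ := compact_exists_isClopen_in_isOpen (hopen U hU) hxU
    exact ⟨V, hV, hxV, U, hU, hVU⟩
  choose W hW hxW hWU using hbasis
  obtain ⟨s, hs, hscover⟩ :=
    TopologicalSpace.countable_cover_nhds fun x => (hW x).isOpen.mem_nhds (hxW x)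
  rcases isEmpty_or_nonempty X with hX | hX
  · exact ⟨∅, by simp, by simp [eq_empty_of_isEmpty], by simp, fun x => isEmptyElim x⟩
  have hsne : s.Nonempty := by
    by_contra h
    rw [not_nonempty_iff_eq_empty] at h
    subst h
    exact empty_ne_univ (by simpa using hscover)
  obtain ⟨e, rfl⟩ := hs.exists_eq_range hsne
  have hV : ∀ n, IsClopen (disjointed (fun n => W (e n)) n) := fun n =>
    disjointedRec (p := fun t => IsClopen t) (fun t i ht => ht.diff (hW (e i))) (hW (e n))
  refine ⟨range (disjointed fun n => W (e n)), ?_, ?_, ?_, fun x => ?_⟩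
  · rintro _ ⟨n, rfl⟩
    exact (hV n).isOpen
  · rw [sUnion_range, iUnion_disjointed, ← hscover, biUnion_range]
  · rintro _ ⟨n, rfl⟩
    obtain ⟨U, hU, hsub⟩ := hWU (e n)
    exact ⟨U, hU, (disjointed_subset _ n).trans hsub⟩
  · have hsub : {V ∈ range (disjointed fun n => W (e n)) | x ∈ V}.Subsingleton := by
      rintro _ ⟨⟨m, rfl⟩, hm⟩ _ ⟨⟨n, rfl⟩, hn⟩
      by_cases hmn : m = n
      · rw [hmn]
      · exact (disjoint_left.1 (disjoint_disjointed _ hmn) hm hn).elim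
    exact ⟨hsub.finite, by simpa using (ncard_le_one hsub.finite).2 hsub⟩

/-- A `1`-Lipschitz real function that takes all values in `[0, r)` on `s` witnesses that `s` has
one-dimensional measure at least `r`. -/
theorem ofReal_le_hausdorffMeasure_of_Ico_subset_image {Y : Type*} [MetricSpace Y]
    [MeasurableSpace Y] [BorelSpace Y] {s : Set Y} {r : ℝ} {φ : Y → ℝ} (hφ : LipschitzWith 1 φ)
    (h : Ico 0 r ⊆ φ '' s) : ENNReal.ofReal r ≤ μH[1] s := by
  calc ENNReal.ofReal r = μH[1] (Ico 0 r) := by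
        rw [hausdorffMeasure_real, Real.volume_Ico, sub_zero]
    _ ≤ μH[1] (φ '' s) := measure_mono h
    _ ≤ μH[1] s := by simpa using hφ.hausdorffMeasure_image_le zero_le_one s

/-- Balls in a connected space have measure at least their radius, for small radii. -/
theorem ofReal_le_hausdorffMeasure_ball {Y : Type*} [MetricSpace Y] [MeasurableSpace Y]
    [BorelSpace Y] [PreconnectedSpace Y] {x z : Y} {r : ℝ} (hr : r ≤ dist z x) :
    ENNReal.ofReal r ≤ μH[1] (ball x r) := by
  refine ofReal_le_hausdorffMeasure_of_Ico_subset_image (LipschitzWith.dist_left x) ?_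
  intro t ht
  have hpre : IsPreconnected (range fun y => dist y x) :=
    isPreconnected_range (continuous_id.dist continuous_const)
  obtain ⟨y, hy⟩ := hpre.ordConnected.out ⟨x, rfl⟩ ⟨z, rfl⟩
    (show t ∈ Icc (dist x x) (dist z x) from ⟨by simpa using ht.1, ht.2.le.trans hr⟩)
  refine ⟨y, ?_, hy⟩
  rw [mem_ball]
  exact hy.trans_lt ht.2

/-- The graph whose edges join distinct points at distance less than `ε`. -/
def proximityGraph (Y : Type*) [MetricSpace Y] (ε : ℝ) : SimpleGraph Y where
  Adj x y := x ≠ y ∧ dist x y < ε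
  symm := ⟨fun x y h => ⟨h.1.symm, by rw [dist_comm]; exact h.2⟩⟩
  loopless := ⟨fun _ h => h.1 rfl⟩

theorem proximityGraph_reachable {Y : Type*} [MetricSpace Y] [PreconnectedSpace Y] {ε : ℝ}
    (hε : 0 < ε) (a b : Y) : (proximityGraph Y ε).Reachable a b := by
  refine PreconnectedSpace.induction₂' (proximityGraph Y ε).Reachable (fun x => ?_)
    ⟨fun _ _ _ h₁ h₂ => SimpleGraph.Reachable.trans h₁ h₂⟩ a b
  filter_upwards [ball_mem_nhds x hε] with y hy
  have h : (proximityGraph Y ε).Reachable x y := by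
    by_cases hxy : x = y
    · rw [hxy]
    · exact SimpleGraph.Adj.reachable ⟨hxy, by rw [dist_comm]; exact hy⟩
  exact ⟨h, h.symm⟩

theorem SimpleGraph.Walk.sub_le_dist_getVert {V : Type*} {G : SimpleGraph V} {a b : V}
    (p : G.Walk a b) (hp : p.length = G.dist a b) {i j : ℕ} (hj : j ≤ p.length) (hij : i ≤ j) :
    j - i ≤ G.dist (p.getVert i) (p.getVert j) := by
  have h₁ : G.dist a (p.getVert i) ≤ i := (G.dist_le (p.take i)).trans (by simp)
  have h₂ : G.dist (p.getVert j) b ≤ p.length - j := (G.dist_le (p.drop j)).trans (by simp)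
  have h₃ := (p.take i).reachable.dist_triangle_left b
  have h₄ := (p.drop j).reachable.dist_triangle_right (p.getVert i)
  omega

/-- In a connected space of finite length, two points are joined by `ε`-chains of uniformly
bounded total length. -/
theorem exists_chain_of_hausdorffMeasure_lt_top {Y : Type*} [MetricSpace Y] [MeasurableSpace Y]
    [BorelSpace Y] [PreconnectedSpace Y] (hfin : μH[1] (univ : Set Y) < ∞) (a b : Y) {ε : ℝ}
    (hε : 0 < ε) (hεab : ε ≤ dist a b) :
    ∃ (g : ℕ → Y) (n : ℕ), g 0 = a ∧ (∀ m, n ≤ m → g m = b) ∧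
      (∀ i, dist (g i) (g (i + 1)) ≤ ε) ∧ n * ε ≤ 4 * (μH[1] (univ : Set Y)).toReal := by
  obtain ⟨p, hp⟩ := (proximityGraph_reachable hε a b).exists_walk_length_eq_dist
  refine ⟨p.getVert, p.length, p.getVert_zero, fun m hm => p.getVert_of_length_le hm,
    fun i => ?_, ?_⟩
  · rcases lt_or_ge i p.length with hi | hi
    · exact (p.adj_getVert_succ hi).2.le
    · rw [p.getVert_of_length_le hi, p.getVert_of_length_le (hi.trans i.le_succ), dist_self]
      exact hε.le
  have hsep : ∀ i j, i + 2 ≤ j → j ≤ p.length → ε ≤ dist (p.getVert i) (p.getVert j) := by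
    intro i j hij hj
    by_contra! hlt
    have hge := p.sub_le_dist_getVert hp hj (by omega : i ≤ j)
    by_cases heq : p.getVert i = p.getVert j
    · rw [heq, SimpleGraph.dist_self] at hge
      omega
    · have : (proximityGraph Y ε).dist (p.getVert i) (p.getVert j) = 1 :=
        SimpleGraph.dist_eq_one_iff_adj.2 ⟨heq, hlt⟩
      omega
  have hball : ∀ x : Y, ENNReal.ofReal (ε / 2) ≤ μH[1] (ball x (ε / 2)) := by
    intro x
    have htri := dist_triangle_right a b x
    rcases le_total (ε / 2) (dist a x) with h | h
    · exact ofReal_le_hausdorffMeasure_ball h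
    · exact ofReal_le_hausdorffMeasure_ball (z := b) (by linarith)
  have hdisj : PairwiseDisjoint (↑(Finset.range (p.length / 2 + 1)))
      fun k => ball (p.getVert (2 * k)) (ε / 2) := by
    intro k hk l hl hkl
    simp only [Finset.coe_range, mem_Iio] at hk hl
    refine ball_disjoint_ball ?_
    rw [add_halves]
    rcases lt_or_gt_of_ne hkl with h | h
    · exact hsep _ _ (by omega) (by omega)
    · rw [dist_comm]
      exact hsep _ _ (by omega) (by omega)
  have hsum : ((p.length / 2 + 1 : ℕ) : ℝ≥0∞) * ENNReal.ofReal (ε / 2) ≤ μH[1] (univ : Set Y) := by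
    calc ((p.length / 2 + 1 : ℕ) : ℝ≥0∞) * ENNReal.ofReal (ε / 2)
        = ∑ k ∈ Finset.range (p.length / 2 + 1), ENNReal.ofReal (ε / 2) := by simp
      _ ≤ ∑ k ∈ Finset.range (p.length / 2 + 1), μH[1] (ball (p.getVert (2 * k)) (ε / 2)) :=
          Finset.sum_le_sum fun k _ => hball _
      _ = μH[1] (⋃ k ∈ Finset.range (p.length / 2 + 1), ball (p.getVert (2 * k)) (ε / 2)) :=
          (measure_biUnion_finset hdisj fun _ _ => measurableSet_ball).symm
      _ ≤ μH[1] (univ : Set Y) := measure_mono (subset_univ _)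
  have hreal := ENNReal.toReal_mono hfin.ne hsum
  rw [ENNReal.toReal_mul, ENNReal.toReal_natCast, ENNReal.toReal_ofReal (by positivity)] at hreal
  have hlen : (p.length : ℝ) ≤ 2 * ((p.length / 2 + 1 : ℕ) : ℝ) := by
    exact_mod_cast (by omega : p.length ≤ 2 * (p.length / 2 + 1))
  nlinarith

theorem dist_le_mul_sub_of_dist_succ_le {Y : Type*} [MetricSpace Y] {g : ℕ → Y} {ε : ℝ}
    (hg : ∀ i, dist (g i) (g (i + 1)) ≤ ε) {m n : ℕ} (hmn : m ≤ n) :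
    dist (g m) (g n) ≤ ε * ((n : ℝ) - m) := by
  calc dist (g m) (g n) ≤ ∑ i ∈ Finset.Ico m n, ε :=
        dist_le_Ico_sum_of_dist_le hmn fun _ _ => hg _
    _ = ε * ((n : ℝ) - m) := by simp [Nat.cast_sub hmn, mul_comm]

/-- Sampling an `ε`-chain at unit speed gives a map which is `1`-Lipschitz up to an error `ε`. -/
theorem dist_floor_div_le {Y : Type*} [MetricSpace Y] {g : ℕ → Y} {ε : ℝ} (hε : 0 < ε)
    (hg : ∀ i, dist (g i) (g (i + 1)) ≤ ε) (s t : ℝ) :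
    dist (g ⌊s / ε⌋₊) (g ⌊t / ε⌋₊) ≤ dist s t + ε := by
  wlog hst : s ≤ t generalizing s t
  · rw [dist_comm, dist_comm s t]
    exact this t s (le_of_not_ge hst)
  have hfloor : ⌊s / ε⌋₊ ≤ ⌊t / ε⌋₊ := Nat.floor_mono (by gcongr)
  refine (dist_le_mul_sub_of_dist_succ_le hg hfloor).trans ?_
  rw [dist_comm, Real.dist_eq, abs_of_nonneg (sub_nonneg.2 hst)]
  have hs : s < ε * (⌊s / ε⌋₊ + 1) := by
    have := Nat.lt_floor_add_one (s / ε)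
    rwa [div_lt_iff₀ hε, mul_comm] at this
  rcases le_total 0 t with ht | ht
  · have ht' : ε * ⌊t / ε⌋₊ ≤ t := by
      have := Nat.floor_le (div_nonneg ht hε.le)
      rwa [le_div_iff₀ hε, mul_comm] at this
    nlinarith
  · rw [Nat.floor_of_nonpos (div_nonpos_of_nonpos_of_nonneg ht hε.le)] at hfloor ⊢
    rw [Nat.le_zero.1 hfloor]
    simp only [sub_self, mul_zero]
    linarith

/-- In a compact connected space of finite length, any two points are joined by a Lipschitz
curve. -/
theorem exists_lipschitzWith_one_of_hausdorffMeasure_lt_top {Y : Type*} [MetricSpace Y]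
    [MeasurableSpace Y] [BorelSpace Y] [CompactSpace Y] [PreconnectedSpace Y]
    (hfin : μH[1] (univ : Set Y) < ∞) {a b : Y} (hab : a ≠ b) :
    ∃ (f : ℝ → Y) (T : ℝ), 0 ≤ T ∧ LipschitzWith 1 f ∧ f 0 = a ∧ f T = b := by
  set T : ℝ := 4 * (μH[1] (univ : Set Y)).toReal with hT
  obtain ⟨ε, -, hε, hεlim⟩ := exists_seq_strictAnti_tendsto' (dist_pos.2 hab)
  choose g n hg0 hgn hgstep hlen using fun k =>
    exists_chain_of_hausdorffMeasure_lt_top hfin a b (hε k).1 (hε k).2.le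
  let l : Ultrafilter ℕ := Ultrafilter.of atTop
  have hl : (l : Filter ℕ) ≤ atTop := Ultrafilter.of_le atTop
  have hlim : ∀ t : ℝ, ∃ y, Tendsto (fun k => g k ⌊t / ε k⌋₊) l (𝓝 y) := fun t =>
    ⟨(l.map fun k => g k ⌊t / ε k⌋₊).lim, (l.map fun k => g k ⌊t / ε k⌋₊).le_nhds_lim⟩
  choose f hf using hlim
  refine ⟨f, T, by positivity, LipschitzWith.of_dist_le_mul fun s t => ?_, ?_, ?_⟩
  · rw [NNReal.coe_one, one_mul]
    have h₁ : Tendsto (fun k => dist s t + ε k) l (𝓝 (dist s t)) := by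
      simpa using (hεlim.mono_left hl).const_add (dist s t)
    exact le_of_tendsto_of_tendsto' ((hf s).dist (hf t)) h₁
      fun k => dist_floor_div_le (hε k).1 (hgstep k) s t
  · refine tendsto_nhds_unique (hf 0) ?_
    simp [hg0]
  · refine tendsto_nhds_unique (hf T) ?_
    have : ∀ k, g k ⌊T / ε k⌋₊ = b := fun k =>
      hgn k _ (Nat.le_floor ((le_div_iff₀ (hε k).1).2 (hlen k)))
    simp [this]

/-- A compact metric space of topological dimension `1` with `H^1(X) < ∞` contains a
`1`-rectifiable subset of positive `H^1`-measure. -/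
theorem stmt13 {X : Type*} [MetricSpace X] [MeasurableSpace X] [BorelSpace X]
    [CompactSpace X] (hdim : CovDimEq X 1)
    (hfin : μH[1] (univ : Set X) < ∞) :
    ∃ E : Set X, IsRectifiableSet1 E ∧ 0 < μH[1] E := by
  have hnot : ¬ TotallyDisconnectedSpace X := fun _ =>
    absurd (hdim.2 0 CovDimLE.zero_of_totallyDisconnectedSpace) (by norm_num)
  obtain ⟨a, b, hab, hne⟩ : ∃ a b : X, b ∈ connectedComponent a ∧ a ≠ b := by
    by_contra! h
    exact hnot (totallyDisconnectedSpace_iff_connectedComponent_singleton.2 fun x =>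
      Subset.antisymm (fun y hy => (h x y hy).symm)
        (singleton_subset_iff.2 mem_connectedComponent))
  set C := connectedComponent a
  have : PreconnectedSpace C := Subtype.preconnectedSpace isPreconnected_connectedComponent
  have : CompactSpace C := isCompact_iff_compactSpace.1 isClosed_connectedComponent.isCompact
  have hC : μH[1] (univ : Set C) < ∞ := by
    rw [← isometry_subtype_coe.hausdorffMeasure_image (Or.inl zero_le_one)]
    exact (measure_mono (subset_univ _)).trans_lt hfin
  obtain ⟨f, T, hT, hf, hf0, hfT⟩ := exists_lipschitzWith_one_of_hausdorffMeasure_lt_top hC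
    (a := ⟨a, mem_connectedComponent⟩) (b := ⟨b, hab⟩) (fun h => hne (congrArg Subtype.val h))
  have hF : LipschitzWith 1 fun t => (f t : X) := by
    simpa [Function.comp_def] using (LipschitzWith.subtype_val C).comp hf
  refine ⟨(fun t => (f t : X)) '' Icc 0 T, ⟨?_, fun _ => Icc 0 T, fun _ t => f t,
    fun _ => measurableSet_Icc, fun _ => ⟨1, hF.lipschitzOnWith⟩,
    by rw [iUnion_const, sdiff_self, measure_empty]⟩, ?_⟩
  · exact (isCompact_Icc.image hF.continuous).isClosed.measurableSet
  · refine (ENNReal.ofReal_pos.2 (dist_pos.2 hne.symm)).trans_le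
      (ofReal_le_hausdorffMeasure_of_Ico_subset_image (LipschitzWith.dist_left a) ?_)
    rw [image_image]
    have hivt := intermediate_value_Icc hT
      ((hF.continuous.dist (continuous_const (y := a))).continuousOn (s := Icc 0 T))
    simp only [hf0, hfT, dist_self] at hivt
    exact Ico_subset_Icc_self.trans hivt
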